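/- arXiv:1610.00805 — 2 statements merged into one kernel-verified Lean document; each statement's English description precedes it below -/
import Mathlib

section
/- For any finite simple graph G, the multivariate edge matching polynomial μ_E(G) is same-phase stable; moreover, for every t = (t_e)_{e∈E} with all t_e > 0, all roots of the univariate restriction μ_E(G)(t z) lie on the negative real axis. -/
open MvPolynomial

/-- A univariate real polynomial is real-rooted: it is identically zero or
all of its complex roots are real. -/
def RealRooted (q : Polynomial ℝ) : Prop :=
  q = 0 ∨ ∀ z : ℂ, Polynomial.aeval z q = 0 → z.im = 0

/-- The univariate restriction `p(t₁ z, …, tₙ z)` of a multivariate polynomial. -/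
noncomputable def diagRestrict {ι : Type*} (p : MvPolynomial ι ℝ) (t : ι → ℝ) : Polynomial ℝ :=
  MvPolynomial.aeval (fun i => Polynomial.C (t i) * Polynomial.X) p

/-- `p` is same-phase stable if every univariate restriction along a positive direction
is real-rooted. -/
def SamePhaseStable {ι : Type*} (p : MvPolynomial ι ℝ) : Prop :=
  ∀ t : ι → ℝ, (∀ i, 0 < t i) → RealRooted (diagRestrict p t)

open scoped Classical in
/-- The multivariate edge matching polynomial `μ_E(G) = Σ_{M matching} Π_{e ∈ M} x_e`,
with one variable for each edge of `G`. -/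
noncomputable def edgeMatchingPoly {V : Type*} [Fintype V] [DecidableEq V]
    (G : SimpleGraph V) : MvPolynomial G.edgeSet ℝ :=
  ∑ M ∈ Finset.univ.filter (fun M : Finset G.edgeSet =>
      ∀ e ∈ M, ∀ f ∈ M, e ≠ f → ∀ x, x ∈ (e : Sym2 V) → x ∉ (f : Sym2 V)),
    ∏ e ∈ M, X e

open scoped Classical in
/-- The matchings of `G` all of whose edges lie inside the vertex set `S`. -/
noncomputable def matchingsWithin {V : Type*} [Fintype V] (G : SimpleGraph V) (S : Finset V) :
    Finset (Finset G.edgeSet) :=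
  Finset.univ.filter fun M =>
    (∀ e ∈ M, ∀ f ∈ M, e ≠ f → ∀ x, x ∈ (e : Sym2 V) → x ∉ (f : Sym2 V)) ∧
      ∀ e ∈ M, ∀ x ∈ (e : Sym2 V), x ∈ S

/-- The weighted sum over the matchings of `G` inside `S`. -/
noncomputable def matchingSum {V : Type*} [Fintype V] (G : SimpleGraph V) (f : G.edgeSet → ℂ)
    (S : Finset V) : ℂ :=
  ∑ M ∈ matchingsWithin G S, ∏ e ∈ M, f e

section

variable {V : Type*} [Fintype V] {G : SimpleGraph V}

theorem mem_matchingsWithin {S : Finset V} {M : Finset G.edgeSet} :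
    M ∈ matchingsWithin G S ↔
      (∀ e ∈ M, ∀ f ∈ M, e ≠ f → ∀ x, x ∈ (e : Sym2 V) → x ∉ (f : Sym2 V)) ∧
        ∀ e ∈ M, ∀ x ∈ (e : Sym2 V), x ∈ S := by
  simp [matchingsWithin]

theorem matchingSum_empty (f : G.edgeSet → ℂ) : matchingSum G f ∅ = 1 := by
  have h : matchingsWithin G (∅ : Finset V) = {∅} := by
    ext M
    rw [mem_matchingsWithin, Finset.mem_singleton]
    constructor
    · rintro ⟨-, h⟩
      refine Finset.eq_empty_of_forall_notMem fun e he => ?_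
      exact absurd (h e he _ (Sym2.out_fst_mem (e : Sym2 V))) (Finset.notMem_empty _)
    · rintro rfl
      simp
  simp [matchingSum, h]

theorem matchingSum_zero (S : Finset V) : matchingSum G (fun _ => 0) S = 1 := by
  rw [matchingSum, Finset.sum_eq_single ∅]
  · simp
  · intro M _ hM
    obtain ⟨e, he⟩ := Finset.nonempty_iff_ne_empty.2 hM
    exact Finset.prod_eq_zero he rfl
  · intro h
    exact absurd (mem_matchingsWithin.2 (by simp)) h

open scoped Classical in
/-- Deleting a vertex: a matching inside `insert v S` either avoids `v` or consists of an edge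
at `v` together with a matching avoiding both endpoints of that edge. -/
theorem matchingSum_insert [DecidableEq V] (f : G.edgeSet → ℂ) {S : Finset V} {v : V} (hv : v ∉ S) :
    matchingSum G f (insert v S) = matchingSum G f S +
      ∑ e ∈ Finset.univ.filter (fun e : G.edgeSet =>
          v ∈ (e : Sym2 V) ∧ ∀ x ∈ (e : Sym2 V), x ∈ insert v S),
        f e * matchingSum G f {x ∈ S | x ∉ (e : Sym2 V)} := by
  unfold matchingSum
  rw [← Finset.sum_filter_not_add_sum_filter (matchingsWithin G (insert v S))
    (fun M => ∃ e ∈ M, v ∈ (e : Sym2 V))]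
  congr 1
  · refine Finset.sum_congr ?_ fun _ _ => rfl
    ext M
    simp only [Finset.mem_filter, mem_matchingsWithin, Finset.mem_insert]
    constructor
    · rintro ⟨⟨hmat, hin⟩, hM⟩
      refine ⟨hmat, fun e he x hx => (hin e he x hx).resolve_left ?_⟩
      rintro rfl
      exact hM ⟨e, he, hx⟩
    · rintro ⟨hmat, hin⟩
      exact ⟨⟨hmat, fun e he x hx => Or.inr (hin e he x hx)⟩,
        fun ⟨e, he, hve⟩ => hv (hin e he v hve)⟩
  · simp_rw [Finset.mul_sum]
    rw [Finset.sum_sigma']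
    symm
    have key : ∀ p ∈ (Finset.univ.filter fun e : G.edgeSet =>
          v ∈ (e : Sym2 V) ∧ ∀ x ∈ (e : Sym2 V), x ∈ insert v S).sigma
          (fun e => matchingsWithin G {x ∈ S | x ∉ (e : Sym2 V)}),
        v ∈ (p.1 : Sym2 V) ∧ ∀ g ∈ p.2, v ∉ (g : Sym2 V) := by
      rintro ⟨e, M⟩ h
      simp only [Finset.mem_sigma, Finset.mem_filter, mem_matchingsWithin] at h
      exact ⟨h.1.2.1, fun g hg hvg => hv (h.2.2 g hg v hvg).1⟩
    have key' : ∀ e : G.edgeSet, ∀ M : Finset G.edgeSet,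
        v ∈ (e : Sym2 V) → (∀ g ∈ M, v ∉ (g : Sym2 V)) → e ∉ M :=
      fun e M he hM h => hM e h he
    refine Finset.sum_bij (fun p _ => insert p.1 p.2) ?_ ?_ ?_ ?_
    · rintro ⟨e, M⟩ h
      simp only [Finset.mem_sigma, Finset.mem_filter, mem_matchingsWithin, Finset.mem_insert,
        Finset.mem_univ, true_and] at h ⊢
      obtain ⟨⟨hve, hin⟩, hmat, hM⟩ := h
      refine ⟨⟨?_, ?_⟩, e, Or.inl rfl, hve⟩
      · rintro a (rfl | ha) b (rfl | hb) hab x hxa hxb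
        · exact hab rfl
        · exact (hM b hb x hxb).2 hxa
        · exact (hM a ha x hxa).2 hxb
        · exact hmat a ha b hb hab x hxa hxb
      · rintro a (rfl | ha) x hx
        · exact hin x hx
        · exact Or.inr (hM a ha x hx).1
    · rintro ⟨e, M⟩ h ⟨e', M'⟩ h' heq
      obtain ⟨h1, h2⟩ := key _ h
      obtain ⟨h1', h2'⟩ := key _ h'
      dsimp only at h1 h2 h1' h2' heq
      have he : e = e' := by
        have : e ∈ insert e' M' := heq ▸ Finset.mem_insert_self e M
        rcases Finset.mem_insert.1 this with h | h
        · exact h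
        · exact absurd h1 (h2' e h)
      subst he
      rw [← Finset.erase_insert (key' e M h1 h2), heq, Finset.erase_insert (key' e M' h1' h2')]
    · intro M hM
      simp only [Finset.mem_filter, mem_matchingsWithin] at hM
      obtain ⟨⟨hmat, hin⟩, e, heM, hve⟩ := hM
      refine ⟨⟨e, M.erase e⟩, ?_, Finset.insert_erase heM⟩
      simp only [Finset.mem_sigma, Finset.mem_filter, mem_matchingsWithin, Finset.mem_univ,
        true_and]
      refine ⟨⟨hve, hin e heM⟩, fun a ha b hb => hmat a (Finset.mem_of_mem_erase ha) b
        (Finset.mem_of_mem_erase hb), fun a ha x hx => ?_⟩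
      have hae := hmat a (Finset.mem_of_mem_erase ha) e heM (Finset.ne_of_mem_erase ha)
      have hxS := hin a (Finset.mem_of_mem_erase ha) x hx
      have := hae x hx
      refine ⟨(Finset.mem_insert.1 hxS).resolve_left ?_, this⟩
      rintro rfl
      exact this hve
    · rintro ⟨e, M⟩ h
      obtain ⟨h1, h2⟩ := key _ h
      exact (Finset.prod_insert (key' e M h1 h2)).symm

theorem Complex.inv_re_pos {a : ℂ} (ha : 0 < a.re) : 0 < a⁻¹.re := by
  rw [Complex.inv_re]
  exact div_pos ha (Complex.normSq_pos.2 fun h => by simp [h] at ha)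

/-- Every point of the slit plane has a square root in the open right half-plane. -/
theorem Complex.exists_re_pos_sq_eq {z : ℂ} (hz : z ∈ Complex.slitPlane) :
    ∃ w : ℂ, 0 < w.re ∧ w ^ 2 = z := by
  obtain ⟨harg, hz0⟩ := Complex.mem_slitPlane_iff_arg.1 hz
  refine ⟨Complex.exp (Complex.log z / 2), ?_, ?_⟩
  · have him : (Complex.log z / 2).im = z.arg / 2 := by simp [Complex.log_im]
    rw [Complex.exp_re, him]
    refine mul_pos (Real.exp_pos _) (Real.cos_pos_of_mem_Ioo ⟨?_, ?_⟩)
    · linarith [Complex.neg_pi_lt_arg z]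
    · linarith [lt_of_le_of_ne (Complex.arg_le_pi z) harg]
  · rw [← Complex.exp_nat_mul, Nat.cast_ofNat, mul_div_cancel₀ _ two_ne_zero,
      Complex.exp_log hz0]

/-- The ratio argument of Heilmann and Lieb: adding a vertex multiplies the matching sum by
`w` times a number in the right half-plane. -/
theorem matchingSum_ne_zero_and_ratio_re_pos [DecidableEq V] (t : G.edgeSet → ℝ)
    (ht : ∀ e, 0 < t e) {w : ℂ} (hw : 0 < w.re) (S : Finset V) :
    matchingSum G (fun e => t e * w ^ 2) S ≠ 0 ∧ ∀ v ∉ S,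
      0 < (matchingSum G (fun e => t e * w ^ 2) (insert v S) /
        (w * matchingSum G (fun e => t e * w ^ 2) S)).re := by
  classical
  have hw0 : w ≠ 0 := fun h => by simp [h] at hw
  induction S using Finset.strongInduction with
  | H S ih =>
  set P := matchingSum G (fun e => t e * w ^ 2) with hP
  have hS : P S ≠ 0 := by
    rcases S.eq_empty_or_nonempty with rfl | ⟨u, hu⟩
    · simp [hP, matchingSum_empty]
    · have h := (ih _ (Finset.erase_ssubset hu)).2 u (Finset.notMem_erase u S)
      rw [Finset.insert_erase hu] at h
      intro h0
      simp [h0] at h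
  refine ⟨hS, fun v hv => ?_⟩
  have hexp : P (insert v S) / (w * P S) = w⁻¹ +
      ∑ e ∈ Finset.univ.filter (fun e : G.edgeSet =>
          v ∈ (e : Sym2 V) ∧ ∀ x ∈ (e : Sym2 V), x ∈ insert v S),
        (t e : ℂ) * (w * P {x ∈ S | x ∉ (e : Sym2 V)} / P S) := by
    rw [hP, matchingSum_insert _ hv, ← hP, add_div, Finset.sum_div]
    congr 1
    · field_simp
    · refine Finset.sum_congr ?_ fun e _ => ?_
      · congr
      · field_simp
  rw [hexp, Complex.add_re, Complex.re_sum]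
  refine add_pos_of_pos_of_nonneg (Complex.inv_re_pos hw) (Finset.sum_nonneg fun e he => ?_)
  obtain ⟨hve, hin⟩ := (Finset.mem_filter.1 he).2
  obtain ⟨u, hu⟩ := hve
  have hne : v ≠ u := by
    have := e.2
    rw [hu, SimpleGraph.mem_edgeSet] at this
    exact this.ne
  have huS : u ∈ S :=
    (Finset.mem_insert.1 (hin u (by rw [hu]; exact Sym2.mem_mk_right v u))).resolve_left hne.symm
  have hfilter : {x ∈ S | x ∉ (e : Sym2 V)} = S.erase u := by
    ext x
    rw [Finset.mem_filter, Finset.mem_erase, hu, Sym2.mem_iff]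
    grind
  have h := (ih _ (Finset.erase_ssubset huS)).2 u (Finset.notMem_erase u S)
  rw [Finset.insert_erase huS] at h
  have h' := Complex.inv_re_pos h
  rw [inv_div] at h'
  rw [hfilter, Complex.re_ofReal_mul]
  exact (mul_pos (ht e) h').le

theorem aeval_diagRestrict_edgeMatchingPoly [DecidableEq V] (t : G.edgeSet → ℝ) (z : ℂ) :
    Polynomial.aeval z (diagRestrict (edgeMatchingPoly G) t) =
      matchingSum G (fun e => t e * z) Finset.univ := by
  simp only [diagRestrict, edgeMatchingPoly, matchingSum, map_sum, map_prod, aeval_X, map_mul,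
    Polynomial.aeval_C, Polynomial.aeval_X, Complex.coe_algebraMap]
  refine Finset.sum_congr ?_ fun _ _ => rfl
  ext M
  simp [mem_matchingsWithin]

theorem neg_of_aeval_diagRestrict_edgeMatchingPoly_eq_zero [DecidableEq V] {t : G.edgeSet → ℝ}
    (ht : ∀ e, 0 < t e) {z : ℂ}
    (hz : Polynomial.aeval z (diagRestrict (edgeMatchingPoly G) t) = 0) :
    z.im = 0 ∧ z.re < 0 := by
  have hslit : z ∉ Complex.slitPlane := by
    intro h
    obtain ⟨w, hw, hsq⟩ := Complex.exists_re_pos_sq_eq h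
    have := (matchingSum_ne_zero_and_ratio_re_pos t ht hw Finset.univ).1
    rw [hsq, ← aeval_diagRestrict_edgeMatchingPoly] at this
    exact this hz
  have hz0 : z ≠ 0 := by
    rintro rfl
    rw [aeval_diagRestrict_edgeMatchingPoly] at hz
    simp [matchingSum_zero] at hz
  rw [Complex.mem_slitPlane_iff, not_or, not_lt, not_not] at hslit
  refine ⟨hslit.2, lt_of_le_of_ne hslit.1 fun h => hz0 (Complex.ext h hslit.2)⟩

end

/-- For any finite simple graph `G`, the multivariate edge matching polynomial `μ_E(G)` is
same-phase stable; moreover for every positive direction `t`, all (complex) roots of the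
univariate restriction `μ_E(G)(t z)` lie on the negative real axis. -/
theorem edgeMatchingPoly_samePhaseStable {V : Type*} [Fintype V] [DecidableEq V]
    (G : SimpleGraph V) :
    SamePhaseStable (edgeMatchingPoly G) ∧
    ∀ t : G.edgeSet → ℝ, (∀ e, 0 < t e) →
      ∀ z : ℂ, Polynomial.aeval z (diagRestrict (edgeMatchingPoly G) t) = 0 →
        z.im = 0 ∧ z.re < 0 := by
  have h : ∀ t : G.edgeSet → ℝ, (∀ e, 0 < t e) →
      ∀ z : ℂ, Polynomial.aeval z (diagRestrict (edgeMatchingPoly G) t) = 0 →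
        z.im = 0 ∧ z.re < 0 :=
    fun _ ht _ hz => neg_of_aeval_diagRestrict_edgeMatchingPoly_eq_zero ht hz
  exact ⟨fun t ht => Or.inr fun z hz => (h t ht z hz).1, h⟩
end

section
/- For any finite simple graph G, the multivariate independence polynomial I(G) is same-phase stable if and only if G is claw-free. -/
open MvPolynomial
open scoped Classical

/-- A graph is claw-free if it has no induced subgraph isomorphic to the claw `K_{1,3}`. -/
def ClawFree {V : Type*} (G : SimpleGraph V) : Prop :=
  IsEmpty (completeBipartiteGraph (Fin 1) (Fin 3) ↪g G)

/-- The multivariate independence polynomial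
`I(G) = Σ_{S independent} Π_{v ∈ S} x_v` of a finite simple graph `G`. -/
noncomputable def indepPoly {α : Type*} [Fintype α] (H : SimpleGraph α) : MvPolynomial α ℝ :=
  ∑ S ∈ Finset.univ.filter (fun S : Finset α => ∀ a ∈ S, ∀ b ∈ S, ¬ H.Adj a b),
    ∏ a ∈ S, X a

section IndependenceSum

variable {V R : Type*} [CommRing R] (G : SimpleGraph V)

/-- The sum of `∏ a ∈ A, w a` over all independent sets `A` contained in `S`. -/
noncomputable def indepSum (w : V → R) (S : Finset V) : R :=
  ∑ A ∈ S.powerset, if ∀ a ∈ A, ∀ b ∈ A, ¬ G.Adj a b then ∏ a ∈ A, w a else 0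

lemma indepSum_empty (w : V → R) : indepSum G w ∅ = 1 := by
  simp [indepSum]

lemma indepSum_congr {w w' : V → R} {S : Finset V} (h : ∀ v ∈ S, w v = w' v) :
    indepSum G w S = indepSum G w' S := by
  refine Finset.sum_congr rfl fun A hA => ?_
  rw [Finset.prod_congr rfl fun a ha => h a (Finset.mem_powerset.1 hA ha)]

lemma indepSum_zero (S : Finset V) : indepSum G (fun _ => (0 : R)) S = 1 := by
  rw [indepSum, Finset.sum_eq_single ∅]
  · simp
  · intro A _ hA
    simp [Finset.prod_const, Finset.card_eq_zero, hA]
  · simp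

lemma indepSum_insert (w : V → R) {S : Finset V} {v : V} (hv : v ∉ S) :
    indepSum G w (insert v S) =
      indepSum G w S + w v * indepSum G w (S.filter fun x => ¬ G.Adj v x) := by
  have hrestrict : (S.filter fun x => ¬ G.Adj v x).powerset =
      S.powerset.filter fun A => ∀ a ∈ A, ¬ G.Adj v a := by
    ext A
    simp only [Finset.mem_powerset, Finset.mem_filter, Finset.subset_iff]
    grind
  rw [indepSum, Finset.sum_powerset_insert hv, indepSum, indepSum, hrestrict, Finset.sum_filter,
    Finset.mul_sum]
  congr 1
  refine Finset.sum_congr rfl fun A hA => ?_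
  have hvA : v ∉ A := fun h => hv (Finset.mem_powerset.1 hA h)
  rw [Finset.prod_insert hvA]
  have hiff : (∀ a ∈ insert v A, ∀ b ∈ insert v A, ¬ G.Adj a b) ↔
      (∀ a ∈ A, ¬ G.Adj v a) ∧ ∀ a ∈ A, ∀ b ∈ A, ¬ G.Adj a b := by
    simp only [Finset.forall_mem_insert, SimpleGraph.irrefl, not_false_eq_true, true_and]
    constructor
    · exact fun h => ⟨h.1, fun a ha => (h.2 a ha).2⟩
    · exact fun h => ⟨h.1, fun a ha => ⟨fun h' => h.1 a ha h'.symm, h.2 a ha⟩⟩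
  simp only [hiff]
  split_ifs <;> simp_all

lemma indepSum_union_clique (w : V → R) (S K : Finset V) (hd : Disjoint S K)
    (hK : G.IsClique (K : Set V)) :
    indepSum G w (S ∪ K) =
      indepSum G w S + ∑ v ∈ K, w v * indepSum G w (S.filter fun x => ¬ G.Adj v x) := by
  induction K using Finset.induction_on with
  | empty => simp
  | insert v K hv ih =>
    rw [Finset.disjoint_insert_right] at hd
    have hfilter : ((S ∪ K).filter fun x => ¬ G.Adj v x) = S.filter fun x => ¬ G.Adj v x := by
      ext x
      simp only [Finset.mem_filter, Finset.mem_union]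
      have : x ∈ K → G.Adj v x := fun hx =>
        hK (by simp) (by simp [hx]) (by rintro rfl; exact hv hx)
      tauto
    rw [Finset.union_insert, indepSum_insert G w (by simp [hd.1, hv]), hfilter,
      ih hd.2 (hK.subset (by simp)), Finset.sum_insert hv]
    ring

lemma continuous_indepSum {X : Type*} [TopologicalSpace X] [TopologicalSpace R]
    [IsTopologicalRing R] {w : X → V → R} (hw : ∀ v, Continuous fun x => w x v) (S : Finset V) :
    Continuous fun x => indepSum G (w x) S := by
  unfold indepSum
  refine continuous_finsetSum _ fun A _ => ?_
  split_ifs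
  · exact continuous_finsetProd _ fun a _ => hw a
  · exact continuous_const

end IndependenceSum

section ClawFree

variable {V : Type*} {G : SimpleGraph V}

lemma ClawFree.adj_of_adj (hG : ClawFree G) {c x y z : V} (hx : G.Adj c x) (hy : G.Adj c y)
    (hz : G.Adj c z) (hxy : ¬ G.Adj x y) (hxz : ¬ G.Adj x z) (nxy : x ≠ y) (nxz : x ≠ z)
    (nyz : y ≠ z) : G.Adj y z := by
  by_contra hyz
  let f : Fin 1 ⊕ Fin 3 → V := Sum.elim (fun _ => c) ![x, y, z]
  have hf : Function.Injective f := by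
    rintro (a | a) (b | b) h
    · simp [Subsingleton.elim a b]
    · fin_cases b <;> simp_all [f]
    · fin_cases a <;> simp_all [f]
    · fin_cases a <;> fin_cases b <;> simp_all [f]
  have hadj : ∀ a b, G.Adj (f a) (f b) ↔ (completeBipartiteGraph (Fin 1) (Fin 3)).Adj a b := by
    rintro (a | a) (b | b)
    · simp [f]
    · fin_cases b <;> simp_all [f]
    · fin_cases a <;> simp_all [f, G.adj_comm]
    · fin_cases a <;> fin_cases b <;> simp_all [f, G.adj_comm]
  exact hG.false ⟨⟨f, hf⟩, hadj _ _⟩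

lemma exists_claw_of_not_clawFree (hG : ¬ ClawFree G) :
    ∃ (c : V) (L : Finset V), L.card = 3 ∧ (∀ x ∈ L, G.Adj c x) ∧
      ∀ x ∈ L, ∀ y ∈ L, ¬ G.Adj x y := by
  rw [ClawFree, not_isEmpty_iff] at hG
  obtain ⟨f⟩ := hG
  refine ⟨f (Sum.inl 0), Finset.univ.map (Function.Embedding.inr.trans f.toEmbedding), ?_, ?_, ?_⟩
  · simp
  · simp
  · simp

end ClawFree

/-- If `p / q` lies in the cone spanned by `1` and `z`, then so does `z * q / p`. -/
lemma exists_mul_eq_cone {z p q : ℂ} {a b : ℝ} (ha : 0 ≤ a) (hb : 0 ≤ b) (hp : p ≠ 0)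
    (h : p = (a + b * z) * q) :
    ∃ a' b' : ℝ, 0 ≤ a' ∧ 0 ≤ b' ∧ z * q = (a' + b' * z) * p := by
  have hne : (a + b * z : ℂ) ≠ 0 := by
    rintro h0
    exact hp (by rw [h, h0, zero_mul])
  set N : ℝ := Complex.normSq (a + b * z) with hN
  have hN0 : 0 < N := Complex.normSq_pos.2 hne
  refine ⟨b * Complex.normSq z / N, a / N, by positivity [Complex.normSq_nonneg z],
    by positivity, ?_⟩
  have hNc : (N : ℂ) = (a + b * z) * (a + b * (starRingEnd ℂ) z) := by
    rw [hN, ← Complex.mul_conj]; simp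
  have hNc0 : (N : ℂ) ≠ 0 := by exact_mod_cast hN0.ne'
  have hz : (Complex.normSq z : ℂ) = z * (starRingEnd ℂ) z := (Complex.mul_conj z).symm
  push_cast
  rw [h, hz]
  field_simp
  rw [hNc]
  ring

lemma ClawFree.indepSum_eq_cone_mul {V : Type*} {G : SimpleGraph V} (hG : ClawFree G) {t : V → ℝ}
    (ht : ∀ v, 0 ≤ t v) {z : ℂ} (S : Finset V)
    (hne : ∀ T ⊆ S, indepSum G (fun v => (t v : ℂ) * z) T ≠ 0) {u v : V} (huv : G.Adj u v)
    (hu : u ∉ S) (hv : v ∉ S) (huS : ∀ x ∈ S, ¬ G.Adj u x) :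
    ∃ a b : ℝ, 0 < a ∧ 0 ≤ b ∧ indepSum G (fun v => (t v : ℂ) * z) S =
      (a + b * z) * indepSum G (fun v => (t v : ℂ) * z) (S.filter fun x => ¬ G.Adj v x) := by
  induction S using Finset.strongInduction generalizing u v with
  | H S ih =>
  set P := indepSum G (fun v => (t v : ℂ) * z) with hP
  set T := S.filter fun x => ¬ G.Adj v x with hT
  set K := S.filter fun x => G.Adj v x with hKdef
  have hTS : T ⊆ S := Finset.filter_subset _ _
  have hdisj : Disjoint T K := (Finset.disjoint_filter_filter_not S S _).symm
  have hunion : T ∪ K = S := by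
    rw [Finset.union_comm]; exact Finset.filter_union_filter_not_eq _ S
  have hclique : G.IsClique (K : Set V) := by
    intro x hx y hy hxy
    simp only [hKdef, Finset.coe_filter, Set.mem_ofPred_eq] at hx hy
    exact hG.adj_of_adj huv.symm hx.2 hy.2 (huS x hx.1) (huS y hy.1)
      (by rintro rfl; exact hu hx.1) (by rintro rfl; exact hu hy.1) hxy
  have hstep : ∀ w ∈ K, ∃ a b : ℝ, 0 ≤ a ∧ 0 ≤ b ∧
      z * P (T.filter fun x => ¬ G.Adj w x) = (a + b * z) * P T := by
    intro w hw
    have hwS : w ∈ S ∧ G.Adj v w := by simpa [hKdef] using hw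
    have hwT : w ∉ T := fun h => Finset.disjoint_left.1 hdisj h hw
    obtain ⟨a, b, ha, hb, hab⟩ := ih T (Finset.ssubset_iff_of_subset hTS |>.2 ⟨w, hwS.1, hwT⟩)
      (fun U hU => hne U (hU.trans hTS)) hwS.2 (fun h => hv (hTS h)) hwT
      (fun x hx => (Finset.mem_filter.1 hx).2)
    exact exists_mul_eq_cone ha.le hb (hne T hTS) hab
  choose! a b ha hb hab using hstep
  refine ⟨1 + ∑ w ∈ K, t w * a w, ∑ w ∈ K, t w * b w,
    add_pos_of_pos_of_nonneg one_pos (Finset.sum_nonneg fun w hw => mul_nonneg (ht w) (ha w hw)),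
    Finset.sum_nonneg fun w hw => mul_nonneg (ht w) (hb w hw), ?_⟩
  conv_lhs => rw [← hunion]
  rw [hP, indepSum_union_clique G _ T K hdisj hclique, ← hP]
  have hterm : ∀ w ∈ K, (t w : ℂ) * z * P (T.filter fun x => ¬ G.Adj w x) =
      (t w * a w + t w * b w * z) * P T := by
    intro w hw
    rw [mul_assoc, hab w hw]
    ring
  rw [Finset.sum_congr rfl hterm, ← Finset.sum_mul, Finset.sum_add_distrib, ← Finset.sum_mul]
  push_cast
  ring

section SamePhase

lemma Complex.inv_mem_slitPlane {x : ℂ} (hx : x ∈ slitPlane) : x⁻¹ ∈ slitPlane := by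
  have hne : x.arg ≠ Real.pi := (Complex.mem_slitPlane_iff_arg.1 hx).1
  rw [Complex.mem_slitPlane_iff_arg, Complex.arg_inv, if_neg hne]
  exact ⟨by linarith [Complex.neg_pi_lt_arg x], inv_ne_zero (Complex.slitPlane_ne_zero hx)⟩

lemma Complex.exists_arg_sub_arg_sub_arg_div {x y : ℂ} (hx : x ≠ 0) (hy : y ≠ 0) :
    ∃ n : ℤ, x.arg - y.arg - (x / y).arg = 2 * Real.pi * n := by
  have h := Complex.arg_div_coe_angle hx hy
  rw [← Real.Angle.coe_sub, eq_comm, Real.Angle.angle_eq_iff_two_pi_dvd_sub] at h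
  exact h

/-- If the arguments of two numbers off the negative axis differ by the argument of their quotient,
also off that axis, then no nonnegative combination of the two numbers equals `-1`. -/
lemma Complex.one_add_ne_zero_of_arg {x y : ℂ} (hx : x ∈ slitPlane) (hy : y ∈ slitPlane)
    (hxy : x / y ∈ slitPlane) (harg : x.arg - y.arg = (x / y).arg) {α β : ℝ} (hα : 0 ≤ α)
    (hβ : 0 ≤ β) : 1 + α * x + β * y ≠ 0 := by
  wlog hle : y.im ≤ x.im generalizing x y α β
  · have hinv : y / x = (x / y)⁻¹ := (inv_div x y).symm
    have hne : (x / y).arg ≠ Real.pi := (Complex.mem_slitPlane_iff_arg.1 hxy).1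
    have := this hy hx (by rw [hinv]; exact Complex.inv_mem_slitPlane hxy)
      (by rw [hinv, Complex.arg_inv, if_neg hne, ← harg]; ring) hβ hα (by linarith)
    rwa [add_right_comm]
  intro h0
  have hre : 1 + α * x.re + β * y.re = 0 := by simpa using congrArg Complex.re h0
  have him : α * x.im + β * y.im = 0 := by simpa using congrArg Complex.im h0
  have key : ∀ {c : ℝ} {w : ℂ}, w ∈ slitPlane → 0 ≤ c → c * w.im = 0 → 0 ≤ c * w.re := by
    intro c w hw hc h
    rcases mul_eq_zero.1 h with rfl | h
    · simp
    · rcases hw with hw | hw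
      · positivity
      · exact absurd h hw
  by_cases hy0 : 0 ≤ y.im
  · have h1 := mul_nonneg hα (hy0.trans hle)
    have h2 := mul_nonneg hβ hy0
    linarith [key hx hα (by linarith), key hy hβ (by linarith)]
  by_cases hx0 : x.im ≤ 0
  · have h1 := mul_nonneg hα (neg_nonneg.2 hx0)
    have h2 := mul_nonneg hβ (neg_nonneg.2 (hle.trans hx0))
    linarith [key hx hα (by linarith), key hy hβ (by linarith)]
  push Not at hy0 hx0
  have hyarg : y.arg < 0 := Complex.arg_neg_iff.2 hy0
  have hxarg : 0 ≤ x.arg := Complex.arg_nonneg_iff.2 hx0.le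
  have hdiv : 0 ≤ (x / y).im := Complex.arg_nonneg_iff.1 (by linarith)
  have hN : 0 < Complex.normSq y := Complex.normSq_pos.2 (Complex.slitPlane_ne_zero hy)
  have hcross : 0 ≤ x.im * y.re - x.re * y.im := by
    rw [Complex.div_im, ← sub_div] at hdiv
    have := mul_nonneg hdiv hN.le
    rwa [div_mul_cancel₀ _ hN.ne'] at this
  have heq : α * (x.im * y.re - x.re * y.im) = y.im := by
    linear_combination y.re * him - y.im * hre
  linarith [mul_nonneg hα hcross]

/-- The condition on arguments in `Complex.one_add_ne_zero_of_arg` is preserved along paths on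
which both numbers and their quotient stay off the negative axis. -/
lemma Complex.one_add_ne_zero_of_homotopy {x y : ℝ → ℂ} (hxc : ContinuousOn x (Set.Icc 0 1))
    (hyc : ContinuousOn y (Set.Icc 0 1)) (hx : ∀ s ∈ Set.Icc (0 : ℝ) 1, x s ∈ slitPlane)
    (hy : ∀ s ∈ Set.Icc (0 : ℝ) 1, y s ∈ slitPlane)
    (hxy : ∀ s ∈ Set.Icc (0 : ℝ) 1, x s / y s ∈ slitPlane) (h0 : x 0 = y 0) {α β : ℝ}
    (hα : 0 ≤ α) (hβ : 0 ≤ β) : 1 + α * x 1 + β * y 1 ≠ 0 := by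
  have m0 : (0 : ℝ) ∈ Set.Icc (0 : ℝ) 1 := by simp
  have m1 : (1 : ℝ) ∈ Set.Icc (0 : ℝ) 1 := by simp
  have hquant : ∀ s ∈ Set.Icc (0 : ℝ) 1,
      ∃ n : ℤ, (x s).arg - (y s).arg - (x s / y s).arg = 2 * Real.pi * n := fun s hs =>
    Complex.exists_arg_sub_arg_sub_arg_div (Complex.slitPlane_ne_zero (hx s hs))
      (Complex.slitPlane_ne_zero (hy s hs))
  have hcarg : ∀ w : ℝ → ℂ, ContinuousOn w (Set.Icc 0 1) →
      (∀ s ∈ Set.Icc (0 : ℝ) 1, w s ∈ slitPlane) →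
      ContinuousOn (fun s => (w s).arg) (Set.Icc 0 1) := fun w hw hs s h =>
    (Complex.continuousAt_arg (hs s h)).comp_continuousWithinAt (hw s h)
  have hcont : ContinuousOn (fun s => |(x s).arg - (y s).arg - (x s / y s).arg|)
      (Set.Icc 0 1) :=
    (((hcarg x hxc hx).sub (hcarg y hyc hy)).sub (hcarg _ (hxc.div hyc fun s hs =>
      Complex.slitPlane_ne_zero (hy s hs)) hxy)).abs
  refine Complex.one_add_ne_zero_of_arg (hx 1 m1) (hy 1 m1) (hxy 1 m1) ?_ hα hβ
  by_contra hne
  have hstart : |(x 0).arg - (y 0).arg - (x 0 / y 0).arg| = 0 := by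
    rw [h0, div_self (Complex.slitPlane_ne_zero (hy 0 m0))]
    simp
  have hend : Real.pi ≤ |(x 1).arg - (y 1).arg - (x 1 / y 1).arg| := by
    obtain ⟨n, hn⟩ := hquant 1 m1
    have hn0 : n ≠ 0 := by
      rintro rfl
      exact hne (by simpa [sub_eq_zero] using hn)
    have h1 : (1 : ℝ) ≤ |(n : ℝ)| := by exact_mod_cast Int.one_le_abs hn0
    rw [hn, abs_mul, abs_of_pos Real.two_pi_pos]
    nlinarith [Real.pi_pos]
  obtain ⟨s, hs, hsπ⟩ := intermediate_value_Icc zero_le_one hcont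
    ⟨hstart.le.trans Real.pi_pos.le, hend⟩
  obtain ⟨n, hn⟩ := hquant s hs
  simp only at hsπ
  rw [hn, abs_mul, abs_of_pos Real.two_pi_pos] at hsπ
  have h2 : 2 * |(n : ℝ)| = 1 :=
    mul_left_cancel₀ Real.pi_ne_zero (by linarith)
  have h3 : 2 * |n| = 1 := by exact_mod_cast h2
  omega

/-- A quotient of nonzero numbers avoids the closed negative axis as soon as no nonnegative
combination vanishes. -/
lemma Complex.div_mem_slitPlane {p q : ℂ} (hq : q ≠ 0) (h : ∀ c : ℝ, 0 ≤ c → p + c * q ≠ 0) :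
    p / q ∈ slitPlane := by
  by_contra hn
  rw [Complex.mem_slitPlane_iff, not_or, not_lt, not_not] at hn
  refine h (-(p / q).re) (by linarith) ?_
  have : p / q = ((p / q).re : ℂ) := Complex.ext (by simp) (by simp [hn.2])
  push_cast
  rw [← this]
  field_simp
  ring

end SamePhase

section NewtonInequality

lemma coeff_mul_coeff_le_sq_of_roots_neg (q : Polynomial ℝ) (h0 : q.coeff 0 = 1)
    (hq : ∀ z : ℂ, Polynomial.aeval z q = 0 → z.im = 0 ∧ z.re < 0) :
    0 ≤ q.coeff 1 ∧ 0 ≤ q.coeff 2 ∧ 0 ≤ q.coeff 3 ∧ q.coeff 2 ≤ q.coeff 1 ^ 2 ∧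
      q.coeff 3 ≤ q.coeff 1 * q.coeff 2 ∧ q.coeff 1 * q.coeff 3 ≤ q.coeff 2 ^ 2 := by
  induction hn : q.natDegree generalizing q with
  | zero =>
    rw [Polynomial.natDegree_eq_zero] at hn
    obtain ⟨c, rfl⟩ := hn
    simp
  | succ n ih =>
    obtain ⟨z, hz⟩ := IsAlgClosed.exists_aeval_eq_zero ℂ q
      (fun h => by simp [Polynomial.natDegree_eq_of_degree_eq_some h] at hn)
    obtain ⟨him, hre⟩ := hq z hz
    have hzr : z = algebraMap ℝ ℂ z.re := Complex.ext (by simp) (by simp [him])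
    have hroot : q.IsRoot z.re := by
      rw [hzr, Polynomial.aeval_algebraMap_apply] at hz
      simpa using hz
    obtain ⟨p, hp⟩ := Polynomial.dvd_iff_isRoot.2 hroot
    set r := -z.re with hr
    have hr0 : 0 < r := by linarith
    have hq' : q = (1 + Polynomial.C r⁻¹ * Polynomial.X) * (Polynomial.C r * p) := by
      have hC : Polynomial.C r⁻¹ * Polynomial.C r = (1 : Polynomial ℝ) := by
        rw [← Polynomial.C_mul, inv_mul_cancel₀ hr0.ne', Polynomial.C_1]
      have : Polynomial.C z.re = - Polynomial.C r := by rw [hr, Polynomial.C_neg, neg_neg]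
      rw [hp, this]
      linear_combination (-Polynomial.X * p) * hC
    set f := Polynomial.C r * p with hf
    have hfdeg : f.natDegree = n := by
      have hf0 : f ≠ 0 := by rintro h; rw [hq', h] at h0; simp at h0
      have hl : (1 + Polynomial.C r⁻¹ * Polynomial.X : Polynomial ℝ).natDegree = 1 := by
        rw [add_comm, ← Polynomial.C_1]; exact Polynomial.natDegree_linear (inv_ne_zero hr0.ne')
      have := Polynomial.natDegree_mul
        (p := (1 + Polynomial.C r⁻¹ * Polynomial.X : Polynomial ℝ)) (q := f)
        (by rintro h; simp [h] at hl) hf0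
      rw [← hq', hl, hn] at this
      omega
    have hc : ∀ k, q.coeff (k + 1) = f.coeff (k + 1) + r⁻¹ * f.coeff k := by
      intro k
      rw [hq', add_mul, one_mul, mul_assoc, Polynomial.coeff_add,
        Polynomial.coeff_C_mul (p := Polynomial.X * f), Polynomial.coeff_X_mul]
    have hf0 : f.coeff 0 = 1 := by
      rw [hq'] at h0
      simpa [Polynomial.mul_coeff_zero] using h0
    obtain ⟨i1, i2, i3, i4, i5, i6⟩ := ih f hf0
      (fun w hw => hq w (by rw [hq', map_mul, hw, mul_zero])) hfdeg
    rw [hc 0, hc 1, hc 2]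
    simp only [zero_add, Nat.reduceAdd, hf0]
    have hs : 0 < r⁻¹ := inv_pos.2 hr0
    generalize r⁻¹ = s at hs
    generalize f.coeff 1 = a at *
    generalize f.coeff 2 = b at *
    generalize f.coeff 3 = c at *
    have hsa := mul_nonneg hs.le i1
    have hsb := mul_nonneg hs.le i2
    refine ⟨by positivity, by positivity, by positivity, ?_, ?_, ?_⟩
    · nlinarith
    · nlinarith [mul_nonneg hsa i1, mul_nonneg hs.le hsa, mul_nonneg hsa hs.le]
    · nlinarith [mul_nonneg hs.le (sub_nonneg.2 i5), mul_nonneg (sq_nonneg s) (sub_nonneg.2 i4)]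

lemma RealRooted.coeff_mul_coeff_le_sq {q : Polynomial ℝ} (hq : RealRooted q)
    (h0 : q.coeff 0 = 1) (hnn : ∀ k, 0 ≤ q.coeff k) :
    q.coeff 1 * q.coeff 3 ≤ q.coeff 2 ^ 2 := by
  rcases hq with rfl | hq
  · simp at h0
  refine (coeff_mul_coeff_le_sq_of_roots_neg q h0 fun z hz => ⟨hq z hz, ?_⟩).2.2.2.2.2
  by_contra! hre
  have hzr : z = algebraMap ℝ ℂ z.re := Complex.ext (by simp) (by simp [hq z hz])
  have hroot : q.eval z.re = 0 := by
    rw [hzr, Polynomial.aeval_algebraMap_apply] at hz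
    simpa using hz
  rw [Polynomial.eval_eq_sum_range, Finset.sum_range_succ', h0] at hroot
  have : 0 ≤ ∑ k ∈ Finset.range q.natDegree, q.coeff (k + 1) * z.re ^ (k + 1) :=
    Finset.sum_nonneg fun k _ => mul_nonneg (hnn _) (pow_nonneg hre _)
  simp at hroot
  linarith

end NewtonInequality

section Coefficients

variable {V : Type*} [Fintype V] (G : SimpleGraph V)

/-- The total weight of the independent sets of size `k`. -/
noncomputable def indepCoeff (t : V → ℝ) (k : ℕ) : ℝ :=
  ∑ S ∈ Finset.univ.filter (fun S : Finset V => (∀ a ∈ S, ∀ b ∈ S, ¬ G.Adj a b) ∧ S.card = k),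
    ∏ a ∈ S, t a

lemma coeff_diagRestrict_indepPoly (t : V → ℝ) (k : ℕ) :
    (diagRestrict (indepPoly G) t).coeff k = indepCoeff G t k := by
  rw [diagRestrict, indepPoly, indepCoeff, map_sum, Polynomial.finsetSum_coeff,
    ← Finset.filter_filter, Finset.sum_filter (fun S : Finset V => S.card = k)]
  refine Finset.sum_congr rfl fun S _ => ?_
  simp only [map_prod, MvPolynomial.aeval_X, Finset.prod_mul_distrib, Finset.prod_const]
  rw [← map_prod, Polynomial.coeff_C_mul_X_pow]
  simp only [eq_comm]

lemma indepCoeff_nonneg {t : V → ℝ} (ht : ∀ v, 0 ≤ t v) (k : ℕ) : 0 ≤ indepCoeff G t k :=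
  Finset.sum_nonneg fun _ _ => Finset.prod_nonneg fun a _ => ht a

lemma indepCoeff_zero (t : V → ℝ) : indepCoeff G t 0 = 1 := by
  rw [indepCoeff, Finset.sum_eq_single ∅]
  · simp
  · intro S hS hne
    simp_all
  · simp

lemma prod_le_indepCoeff {t : V → ℝ} (ht : ∀ v, 0 ≤ t v) {S : Finset V}
    (hS : ∀ a ∈ S, ∀ b ∈ S, ¬ G.Adj a b) : ∏ a ∈ S, t a ≤ indepCoeff G t S.card :=
  Finset.single_le_sum (f := fun S : Finset V => ∏ a ∈ S, t a)
    (fun _ _ => Finset.prod_nonneg fun a _ => ht a) (by simpa using hS)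

lemma SamePhaseStable.indepCoeff_mul_le_sq (h : SamePhaseStable (indepPoly G)) {t : V → ℝ}
    (ht : ∀ v, 0 ≤ t v) :
    indepCoeff G t 1 * indepCoeff G t 3 ≤ indepCoeff G t 2 ^ 2 := by
  have hcont : ∀ k, Continuous fun ε : ℝ => indepCoeff G (fun v => t v + ε) k := by
    intro k
    unfold indepCoeff
    fun_prop
  have hpos : ∀ ε ∈ Set.Ioi (0 : ℝ), indepCoeff G (fun v => t v + ε) 1 *
      indepCoeff G (fun v => t v + ε) 3 ≤ indepCoeff G (fun v => t v + ε) 2 ^ 2 := by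
    intro ε hε
    have hε' : ∀ v, 0 < t v + ε := fun v => add_pos_of_nonneg_of_pos (ht v) hε
    have := (h (fun v => t v + ε) hε').coeff_mul_coeff_le_sq
    simp only [coeff_diagRestrict_indepPoly] at this
    exact this (indepCoeff_zero G _) (indepCoeff_nonneg G fun v => (hε' v).le)
  have hclosed : IsClosed {ε : ℝ | indepCoeff G (fun v => t v + ε) 1 *
      indepCoeff G (fun v => t v + ε) 3 ≤ indepCoeff G (fun v => t v + ε) 2 ^ 2} :=
    isClosed_le ((hcont 1).mul (hcont 3)) ((hcont 2).pow 2)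
  have h0 : indepCoeff G (fun v => t v + 0) 1 * indepCoeff G (fun v => t v + 0) 3 ≤
      indepCoeff G (fun v => t v + 0) 2 ^ 2 :=
    closure_minimal hpos hclosed (show (0 : ℝ) ∈ closure (Set.Ioi 0) by simp)
  simpa using h0

lemma SamePhaseStable.clawFree (h : SamePhaseStable (indepPoly G)) : ClawFree G := by
  by_contra hG
  obtain ⟨c, L, hcard, hadj, hL⟩ := exists_claw_of_not_clawFree hG
  have hcL : c ∉ L := fun hc => G.irrefl (hadj c hc)
  set t : V → ℝ := fun v => if v = c then 10 else if v ∈ L then 1 else 0 with ht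
  have ht0 : ∀ v, 0 ≤ t v := by
    intro v
    simp only [ht]
    split_ifs <;> norm_num
  have htL : ∀ S ⊆ L, ∏ a ∈ S, t a = 1 := fun S hS => Finset.prod_eq_one fun a ha => by
    have : a ≠ c := by rintro rfl; exact hcL (hS ha)
    simp [ht, this, hS ha]
  have h1 : 10 ≤ indepCoeff G t 1 := by
    have := prod_le_indepCoeff G ht0 (S := {c}) (by simp)
    simpa [ht] using this
  have h3 : 1 ≤ indepCoeff G t 3 := by
    have := prod_le_indepCoeff G ht0 hL
    rwa [htL L subset_rfl, hcard] at this
  have h2 : indepCoeff G t 2 ≤ 3 := by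
    calc indepCoeff G t 2 ≤ ∑ S ∈ L.powersetCard 2, ∏ a ∈ S, t a := by
          rw [indepCoeff, ← Finset.sum_filter_ne_zero]
          refine Finset.sum_le_sum_of_subset_of_nonneg (fun S hS' => ?_)
            fun S _ _ => Finset.prod_nonneg fun a _ => ht0 a
          simp only [Finset.mem_filter, Finset.mem_univ, true_and] at hS'
          obtain ⟨hS, hne⟩ := hS'
          have hmem : ∀ a ∈ S, a = c ∨ a ∈ L := by
            intro a ha
            by_contra! hn
            exact hne (Finset.prod_eq_zero ha (by simp [ht, hn]))
          refine Finset.mem_powersetCard.2 ⟨fun a ha => (hmem a ha).resolve_left ?_, hS.2⟩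
          rintro rfl
          obtain ⟨b, hb, hba⟩ := Finset.exists_mem_ne (by omega : 1 < S.card) a
          exact hS.1 a ha b hb (hadj b ((hmem b hb).resolve_left hba))
      _ = 3 := by
          rw [Finset.sum_congr rfl fun S hS => htL S (Finset.mem_powersetCard.1 hS).1]
          simp [hcard]
  have := SamePhaseStable.indepCoeff_mul_le_sq G h ht0
  nlinarith [indepCoeff_nonneg G ht0 2]

end Coefficients

section Stability

variable {V : Type*} {G : SimpleGraph V}

lemma eq_zero_of_cone_eq_zero {z : ℂ} (hz : 0 < z.im) {a b : ℝ} (h : (a + b * z : ℂ) = 0) :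
    a = 0 := by
  have him : b = 0 := by
    have := congrArg Complex.im h
    simpa [hz.ne'] using this
  simpa [him] using h

lemma ClawFree.div_mem_slitPlane (hG : ClawFree G) {t : V → ℝ} (ht : ∀ v, 0 ≤ t v) {z : ℂ}
    (hz : 0 < z.im) {u v : V} (huv : G.Adj u v) {S : Finset V} (hu : u ∉ S) (hv : v ∉ S)
    (hne : ∀ T ⊆ S, indepSum G (fun v => (t v : ℂ) * z) T ≠ 0) :
    indepSum G (fun v => (t v : ℂ) * z) (S.filter fun x => ¬ G.Adj u x) /
      indepSum G (fun v => (t v : ℂ) * z) (S.filter fun x => ¬ G.Adj v x) ∈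
        Complex.slitPlane := by
  have hsub : ∀ w, (S.filter fun x => ¬ G.Adj w x) ⊆ S := fun w => Finset.filter_subset _ _
  obtain ⟨a, b, ha, hb, hab⟩ := hG.indepSum_eq_cone_mul ht (S.filter fun x => ¬ G.Adj u x)
    (fun T hT => hne T (hT.trans (hsub u))) huv (fun h => hu (hsub u h)) (fun h => hv (hsub u h))
    (fun x hx => (Finset.mem_filter.1 hx).2)
  obtain ⟨a', b', ha', hb', hab'⟩ := hG.indepSum_eq_cone_mul ht (S.filter fun x => ¬ G.Adj v x)
    (fun T hT => hne T (hT.trans (hsub v))) huv.symm (fun h => hv (hsub v h))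
    (fun h => hu (hsub v h)) (fun x hx => (Finset.mem_filter.1 hx).2)
  have hcomm : ((S.filter fun x => ¬ G.Adj v x).filter fun x => ¬ G.Adj u x) =
      (S.filter fun x => ¬ G.Adj u x).filter fun x => ¬ G.Adj v x := Finset.filter_comm _ _ _
  rw [hcomm] at hab'
  refine Complex.div_mem_slitPlane (hne _ (hsub v)) fun c hc h0 => ?_
  rw [hab, hab'] at h0
  have hM := hne ((S.filter fun x => ¬ G.Adj u x).filter fun x => ¬ G.Adj v x)
    ((Finset.filter_subset _ _).trans (hsub u))
  have hcone : (((a + c * a' : ℝ) : ℂ) + ((b + c * b' : ℝ) : ℂ) * z) = 0 := by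
    refine (mul_eq_zero.1 ?_).resolve_right hM
    push_cast
    linear_combination h0
  have := eq_zero_of_cone_eq_zero hz hcone
  have : 0 ≤ c * a' := by positivity
  linarith

/-- Expanding along an edge `uv` writes the independence sum as a combination of three pairwise
compatible terms; the homotopy scaling all weights from `0` to `1` shows that they are jointly
compatible. -/
theorem ClawFree.indepSum_ne_zero (hG : ClawFree G) {z : ℂ} (hz : 0 < z.im) (S : Finset V)
    {t : V → ℝ} (ht : ∀ v, 0 ≤ t v) : indepSum G (fun v => (t v : ℂ) * z) S ≠ 0 := by
  induction S using Finset.strongInduction generalizing t with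
  | H S ih =>
  by_cases hedge : ∃ u ∈ S, ∃ v ∈ S, G.Adj u v
  · obtain ⟨u, huS, v, hvS, huv⟩ := hedge
    set R := S \ {u, v} with hR
    have hRS : R ⊆ S := Finset.sdiff_subset
    have huR : u ∉ R := by simp [hR]
    have hvR : v ∉ R := by simp [hR]
    have hsub : ∀ w, (R.filter fun x => ¬ G.Adj w x) ⊆ R := fun w => Finset.filter_subset _ _
    have hst : ∀ s ∈ Set.Icc (0 : ℝ) 1, ∀ w, 0 ≤ s * t w := fun s hs w => mul_nonneg hs.1 (ht w)
    set P : ℝ → Finset V → ℂ := fun s T => indepSum G (fun w => ((s * t w : ℝ) : ℂ) * z) T with hP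
    have hPne : ∀ s ∈ Set.Icc (0 : ℝ) 1, ∀ T ⊆ R, P s T ≠ 0 := fun s hs T hT =>
      ih T ((Finset.ssubset_iff_of_subset (hT.trans hRS)).2 ⟨u, huS, fun h => huR (hT h)⟩)
        (hst s hs)
    have hPcont : ∀ T, Continuous fun s => P s T := fun T =>
      continuous_indepSum G (fun w => by fun_prop) T
    have hPair : ∀ w ∈ S, w ∉ R → insert w R ⊂ S → ∀ s ∈ Set.Icc (0 : ℝ) 1,
        z * P s (R.filter fun x => ¬ G.Adj w x) / P s R ∈ Complex.slitPlane := by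
      intro w hwS hwR hss s hs
      rw [← inv_div]
      refine Complex.inv_mem_slitPlane <| Complex.div_mem_slitPlane ?_ fun c hc => ?_
      · refine mul_ne_zero (by rintro rfl; simp at hz) (hPne s hs _ (hsub w))
      have hupd : ∀ x, 0 ≤ Function.update (fun x => s * t x) w c x := by
        intro x
        rcases eq_or_ne x w with rfl | hx
        · simpa using hc
        · simpa [hx] using hst s hs x
      have := ih (insert w R) hss hupd
      have hcongr : ∀ T ⊆ R, indepSum G
          (fun x => ((Function.update (fun x => s * t x) w c x : ℝ) : ℂ) * z) T = P s T :=
        fun T hT => indepSum_congr G fun x hx => by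
          rw [Function.update_of_ne (by rintro rfl; exact hwR (hT hx))]
      rw [indepSum_insert G _ hwR, hcongr R subset_rfl, hcongr _ (hsub w),
        Function.update_self] at this
      rwa [← mul_assoc]
    have hz0 : z ≠ 0 := by rintro rfl; simp at hz
    have m1 : (1 : ℝ) ∈ Set.Icc (0 : ℝ) 1 := by simp
    have hmain := Complex.one_add_ne_zero_of_homotopy
      (x := fun s => z * P s (R.filter fun x => ¬ G.Adj u x) / P s R)
      (y := fun s => z * P s (R.filter fun x => ¬ G.Adj v x) / P s R)
      ((continuous_const.mul (hPcont _)).continuousOn.div (hPcont R).continuousOn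
        fun s hs => hPne s hs R subset_rfl)
      ((continuous_const.mul (hPcont _)).continuousOn.div (hPcont R).continuousOn
        fun s hs => hPne s hs R subset_rfl)
      (hPair u huS huR ((Finset.ssubset_iff_of_subset (by grind)).2
        ⟨v, hvS, by simp [hvR, huv.ne']⟩))
      (hPair v hvS hvR ((Finset.ssubset_iff_of_subset (by grind)).2
        ⟨u, huS, by simp [huR, huv.ne]⟩))
      (fun s hs => by
        rw [div_div_div_cancel_right₀ (hPne s hs R subset_rfl), mul_div_mul_left _ _ hz0]
        exact hG.div_mem_slitPlane (hst s hs) hz huv huR hvR (hPne s hs))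
      (by simp [hP, indepSum_zero]) (ht u) (ht v)
    have hunion : S = R ∪ {u, v} := by
      rw [hR, Finset.sdiff_union_of_subset]
      simp [Finset.insert_subset_iff, huS, hvS]
    have hP1 : ∀ T, P 1 T = indepSum G (fun w => (t w : ℂ) * z) T := fun T => by simp [hP]
    rw [hunion, indepSum_union_clique G _ R {u, v} Finset.sdiff_disjoint (by simp [huv, huv.ne]),
      Finset.sum_pair huv.ne]
    simp only [hP1] at hmain
    have hR0 := hPne 1 m1 R subset_rfl
    rw [hP1] at hR0
    generalize indepSum G (fun w => (t w : ℂ) * z) R = p at hmain hR0 ⊢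
    generalize indepSum G (fun w => (t w : ℂ) * z) (R.filter fun x => ¬ G.Adj u x) = q at hmain ⊢
    generalize indepSum G (fun w => (t w : ℂ) * z) (R.filter fun x => ¬ G.Adj v x) = r at hmain ⊢
    intro h0
    apply hmain
    field_simp
    linear_combination h0
  · push Not at hedge
    rcases S.eq_empty_or_nonempty with rfl | ⟨v, hv⟩
    · simp [indepSum_empty]
    have hfilter : ((S.erase v).filter fun x => ¬ G.Adj v x) = S.erase v :=
      Finset.filter_true_of_mem fun x hx => hedge v hv x (Finset.mem_of_mem_erase hx)
    rw [← Finset.insert_erase hv, indepSum_insert G _ (Finset.notMem_erase v S), hfilter]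
    have hrest := ih (S.erase v) (Finset.erase_ssubset hv) ht
    intro h0
    have hcone : ((1 : ℝ) + (t v : ℝ) * z : ℂ) = 0 := by
      refine (mul_eq_zero.1 ?_).resolve_right hrest
      push_cast
      linear_combination h0
    exact one_ne_zero (eq_zero_of_cone_eq_zero hz hcone)

lemma aeval_diagRestrict_indepPoly [Fintype V] (t : V → ℝ) (z : ℂ) :
    Polynomial.aeval z (diagRestrict (indepPoly G) t) =
      indepSum G (fun v => (t v : ℂ) * z) Finset.univ := by
  rw [diagRestrict, indepPoly, indepSum, Finset.powerset_univ, Finset.sum_filter, map_sum, map_sum]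
  refine Finset.sum_congr rfl fun A _ => ?_
  split_ifs <;> simp

lemma ClawFree.samePhaseStable [Fintype V] (hG : ClawFree G) : SamePhaseStable (indepPoly G) := by
  refine fun t ht => Or.inr fun z hz => ?_
  have hpos : ∀ w : ℂ, Polynomial.aeval w (diagRestrict (indepPoly G) t) = 0 → w.im ≤ 0 := by
    intro w hw
    by_contra! him
    rw [aeval_diagRestrict_indepPoly] at hw
    exact hG.indepSum_ne_zero him _ (fun v => (ht v).le) hw
  have hconj := hpos ((starRingEnd ℂ) z) (by rw [Polynomial.aeval_conj, hz, map_zero])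
  rw [Complex.conj_im] at hconj
  linarith [hpos z hz]

end Stability

/-- For any finite simple graph `G`, the multivariate independence polynomial `I(G)` is
same-phase stable if and only if `G` is claw-free. -/
theorem indepPoly_samePhaseStable_iff_clawFree {V : Type*} [Fintype V]
    (G : SimpleGraph V) :
    SamePhaseStable (indepPoly G) ↔ ClawFree G :=
  ⟨SamePhaseStable.clawFree G, ClawFree.samePhaseStable⟩
end
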